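/- arXiv:0805.1342 — 5 statements merged into one kernel-verified Lean document; each statement's English description precedes it below -/
import Mathlib

section
/- Let 𝔤 be a finite-dimensional Lie algebra over k, V a finite-dimensional representation of 𝔤, and 𝔥 an ideal of 𝔤 such that r_𝔥(V) = r_𝔤(V). Then (SV)^𝔥_si = (SV)^𝔤_si. -/
open Module MvPolynomial

namespace Paper

variable (k : Type) [Field k]

/-- The stabilizer `𝔤_x` of `x ∈ 𝔤*`. -/
def stab (L : Type) [LieRing L] [LieAlgebra k L] (x : Module.Dual k L) : Submodule k L where
  carrier := {v | ∀ w, x ⁅v, w⁆ = 0}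
  add_mem' := by intro a b ha hb w; simp [add_lie, ha w, hb w]
  zero_mem' := by intro w; simp
  smul_mem' := by intro c a ha w; simp [smul_lie, ha w]

/-- The index `i(𝔤)` of a Lie algebra: the minimal dimension of a stabilizer. -/
noncomputable def lieIndex (L : Type) [LieRing L] [LieAlgebra k L] : ℕ :=
  ⨅ x : Module.Dual k L, finrank k (stab k L x)

/-- The set of non-regular elements `𝔤* \ 𝔤*_reg`. -/
def nonReg (L : Type) [LieRing L] [LieAlgebra k L] : Set (Module.Dual k L) :=
  {x | finrank k (stab k L x) ≠ lieIndex k L}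

variable {k}
variable {L : Type} [LieRing L] [LieAlgebra k L]

/-- The element of the polynomial model of the symmetric algebra `S(V)`
(w.r.t. the basis `bV`) corresponding to a vector `v ∈ V`. -/
noncomputable def rep {ι V : Type} [Fintype ι] [AddCommGroup V] [Module k V]
    (bV : Basis ι k V) (v : V) : MvPolynomial ι k :=
  ∑ i, MvPolynomial.C (bV.repr v i) * MvPolynomial.X i

/-- The action of `v ∈ 𝔤` on the symmetric algebra `S(V)` of a `𝔤`-module `V`,
as a derivation (extending `w ↦ v · w = ⁅v, w⁆`). -/
noncomputable def actDer {ι V : Type} [Fintype ι] [AddCommGroup V] [Module k V]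
    [LieRingModule L V] (bV : Basis ι k V) (v : L) :
    Derivation k (MvPolynomial ι k) (MvPolynomial ι k) :=
  MvPolynomial.mkDerivation k fun i => rep bV ⁅v, bV i⁆

/-- Semi-invariants in `S(V)` for the action of a (sub)space `A` mapping to `𝔤` via `em`:
nonzero `f` with `a · f = χ(a) • f` for some weight `χ ∈ A*`. -/
noncomputable def semiInvSet {ι V A : Type} [Fintype ι] [AddCommGroup V] [Module k V]
    [LieRingModule L V] [AddCommGroup A] [Module k A]
    (bV : Basis ι k V) (em : A → L) : Set (MvPolynomial ι k) :=
  {f | f ≠ 0 ∧ ∃ χ : Module.Dual k A, ∀ a : A, actDer bV (em a) f = χ a • f}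

/-- The semi-center: the subalgebra generated by all semi-invariants. -/
noncomputable def semiCenter {ι V A : Type} [Fintype ι] [AddCommGroup V] [Module k V]
    [LieRingModule L V] [AddCommGroup A] [Module k A]
    (bV : Basis ι k V) (em : A → L) : Subalgebra k (MvPolynomial ι k) :=
  Algebra.adjoin k (semiInvSet bV em)

/-- The subalgebra of invariants in `S(V)`. -/
noncomputable def invariants {ι V A : Type} [Fintype ι] [AddCommGroup V] [Module k V]
    [LieRingModule L V] (bV : Basis ι k V) (em : A → L) : Subalgebra k (MvPolynomial ι k) where
  carrier := {f | ∀ a : A, actDer bV (em a) f = 0}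
  mul_mem' := by intro f g hf hg a; simp [Derivation.leibniz, hf a, hg a]
  one_mem' := by intro a; simp
  add_mem' := by intro f g hf hg a; simp [hf a, hg a]
  zero_mem' := by intro a; simp
  algebraMap_mem' := by intro c a; simp

/-- The structure matrix `B = ([v_i, v_j])_{ij}` of `𝔤` w.r.t. a basis. -/
noncomputable def structMat {ι : Type} [Fintype ι] (b : Basis ι k L) :
    Matrix ι ι (MvPolynomial ι k) :=
  Matrix.of fun i j => rep b ⁅b i, b j⁆

/-- The set of `s × s` minors of the structure matrix. -/
noncomputable def minorsSet {ι : Type} [Fintype ι] [DecidableEq ι] (b : Basis ι k L) (s : ℕ) :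
    Set (MvPolynomial ι k) :=
  {p | ∃ f g : Fin s ↪ ι, p = ((structMat b).submatrix f g).det}

/-- `g` is a greatest common divisor of the set `A`. -/
def IsGcdOf {α : Type} [CommMonoidWithZero α] (g : α) (A : Set α) : Prop :=
  (∀ a ∈ A, g ∣ a) ∧ ∀ c, (∀ a ∈ A, c ∣ a) → c ∣ g

/-- The Pfaffian of an `n × n` matrix (`n = 2m` even), via the standard formula
`pf(A) = (2^m m!)⁻¹ Σ_σ sgn(σ) Π_i A_{σ(2i) σ(2i+1)}` (valid in characteristic zero). -/
noncomputable def pfaffian {n : ℕ} {R : Type} [CommRing R] [Algebra ℚ R]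
    (A : Matrix (Fin n) (Fin n) R) : R :=
  ((2 ^ (n / 2) * (n / 2).factorial : ℚ)⁻¹) •
    ∑ σ : Equiv.Perm (Fin n), (Equiv.Perm.sign σ : ℤ) •
      ∏ i : Fin (n / 2),
        A (σ ⟨2 * i.1, by have := i.2; omega⟩) (σ ⟨2 * i.1 + 1, by have := i.2; omega⟩)

/-- The set of Pfaffians of the principal `s × s` minors of the structure matrix. -/
noncomputable def principalPfaffians {ι : Type} [Fintype ι] [DecidableEq ι] [CharZero k]
    (b : Basis ι k L) (s : ℕ) : Set (MvPolynomial ι k) :=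
  {p | ∃ f : Fin s ↪ ι, p = pfaffian ((structMat b).submatrix f f)}

/-- Evaluation of a polynomial in `S𝔤` at a point `x ∈ 𝔤*`. -/
noncomputable def evalAt {ι : Type} [Fintype ι] (b : Basis ι k L) (x : Module.Dual k L) :
    MvPolynomial ι k →ₐ[k] k :=
  MvPolynomial.aeval fun i => x (b i)

/-- The vanishing ideal of a subset `Z ⊆ 𝔤*`. -/
noncomputable def vanIdeal {ι : Type} [Fintype ι] (b : Basis ι k L)
    (Z : Set (Module.Dual k L)) : Ideal (MvPolynomial ι k) where
  carrier := {f | ∀ x ∈ Z, evalAt b x f = 0}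
  add_mem' := by intro f g hf hg x hx; simp [map_add, hf x hx, hg x hx]
  zero_mem' := by intro x hx; simp
  smul_mem' := by intro c f hf x hx; simp [smul_eq_mul, map_mul, hf x hx]

/-- The dimension (Krull dimension of the coordinate ring) of the Zariski closure of
a subset `Z ⊆ 𝔤*`. -/
noncomputable def closedDim {ι : Type} [Fintype ι] (b : Basis ι k L)
    (Z : Set (Module.Dual k L)) : WithBot (WithTop ℕ) :=
  ringKrullDim (MvPolynomial ι k ⧸ vanIdeal b Z)

/-- The rank `r_𝔞(V)` of the structure matrix of the `𝔤`-module `V` with respect to a family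
`vs` spanning the acting subalgebra `𝔞`, computed over the fraction field of `S(V)`. -/
noncomputable def rkFam {ι V κ : Type} [Fintype ι] [DecidableEq ι] [Fintype κ]
    [AddCommGroup V] [Module k V] [LieRingModule L V]
    (bV : Basis ι k V) (vs : κ → L) : ℕ :=
  Matrix.rank ((Matrix.of fun (j : ι) (i : κ) => rep bV ⁅vs i, bV j⁆).map
    (algebraMap (MvPolynomial ι k) (FractionRing (MvPolynomial ι k))))

/-- The map `ρ : A ⊗_k 𝔤 → Der_k(A)` induced by an action of `𝔤` (given on a basis `bG`)
by derivations on a commutative `k`-algebra `A`; `ρ(a ⊗ v) = a • D(v)`. -/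
noncomputable def rhoMap {A G κ : Type} [CommRing A] [Algebra k A]
    [AddCommGroup G] [Module k G]
    (bG : Basis κ k G) (D : G → Derivation k A A) :
    TensorProduct k A G →ₗ[A] (A →ₗ[k] A) :=
  (Basis.baseChange A bG).constr k fun i => (D (bG i)).toLinearMap

/-- The invariant subfield `F^𝔤` for an action of `𝔤` by derivations on a field `F ⊇ k`. -/
noncomputable def invField {F G : Type} [Field F] [Algebra k F]
    (D : G → Derivation k F F) : IntermediateField k F where
  carrier := {x | ∀ v : G, D v x = 0}
  mul_mem' := by intro a b ha hb v; simp [Derivation.leibniz, ha v, hb v]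
  one_mem' := by intro v; simp
  add_mem' := by intro a b ha hb v; simp [ha v, hb v]
  zero_mem' := by intro v; simp
  algebraMap_mem' := by intro c v; simp
  inv_mem' := by
    intro x hx v
    rcases eq_or_ne x 0 with h | h
    · simp [h]
    · have h1 : D v (x * x⁻¹) = 0 := by
        rw [mul_inv_cancel₀ h]; simp
      rw [Derivation.leibniz] at h1
      have h2 : x • D v x⁻¹ = 0 := by
        rw [hx v] at h1; simpa using h1
      rcases smul_eq_zero.1 h2 with h3 | h3
      · exact absurd h3 h
      · exact h3

/-- The action of `𝔤` on a field `F` by derivations is *geometric* if the natural map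
`F ⊗_{F^𝔤} 𝔤 → Der_{F^𝔤}(F)` is surjective, i.e. every `k`-derivation of `F` vanishing
on the invariant subfield `F^𝔤` lies in the `F`-span of the derivations coming from `𝔤`. -/
def IsGeometric {F G : Type} [Field F] [Algebra k F]
    (D : G → Derivation k F F) : Prop :=
  ∀ E : Derivation k F F, (∀ x : F, (∀ v : G, D v x = 0) → E x = 0) →
    E.toLinearMap ∈ Submodule.span F (Set.range fun v : G => (D v).toLinearMap)


/-- The subalgebra of invariants for an action of `G` by derivations on a
commutative `k`-algebra `A`. -/
noncomputable def invariantsOf {A G : Type} [CommRing A] [Algebra k A]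
    (D : G → Derivation k A A) : Subalgebra k A where
  carrier := {f | ∀ v : G, D v f = 0}
  mul_mem' := by intro f g hf hg v; simp [Derivation.leibniz, hf v, hg v]
  one_mem' := by intro v; simp
  add_mem' := by intro f g hf hg v; simp [hf v, hg v]
  zero_mem' := by intro v; simp
  algebraMap_mem' := by intro c v; simp

/-- The map `ρ* : S(V) ⊗ V → S(V) ⊗ 𝔤*` dual to the action map, determined by
`ρ*(1 ⊗ w)(v) = v · w`. -/
noncomputable def rhoStar {ι ιV V : Type} [Fintype ι] [Fintype ιV]
    [AddCommGroup V] [Module k V] [LieRingModule L V]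
    (b : Basis ι k L) (bV : Basis ιV k V) :
    TensorProduct k (MvPolynomial ιV k) V →ₗ[MvPolynomial ιV k]
      TensorProduct k (MvPolynomial ιV k) (Module.Dual k L) :=
  (Basis.baseChange (MvPolynomial ιV k) bV).constr k fun j =>
    ∑ i, (rep bV ⁅b i, bV j⁆) ⊗ₜ[k] (b.coord i)

/-- A bundled finite-dimensional Lie algebra over `k` together with a finite basis
(providing a polynomial model of its symmetric algebra). -/
structure FDLieModel (k : Type) [Field k] where
  carrier : Type
  [lieRing : LieRing carrier]
  [lieAlg : LieAlgebra k carrier]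
  ind : Type
  [fin : Fintype ind]
  [deceq : DecidableEq ind]
  basis : Basis ind k carrier

attribute [instance] FDLieModel.lieRing FDLieModel.lieAlg FDLieModel.fin FDLieModel.deceq


theorem lie_lie_eq_smul_of_weight {k L W : Type*} [Field k] [CharZero k] [LieRing L]
    [LieAlgebra k L] [AddCommGroup W] [Module k W] [Module.Finite k W] [LieRingModule L W]
    [LieModule k L W] (I : LieIdeal k L) (χ : I → k) (f : W)
    (hf : ∀ a : I, ⁅(a : L), f⁆ = χ a • f) (v : L) (a : I) :
    ⁅(a : L), ⁅v, f⁆⁆ = χ a • ⁅v, f⁆ := by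
  have hF : f ∈ LieModule.weightSpaceOfIsLieTower (L := L) k W χ :=
    (LieModule.mem_weightSpace (χ := χ) f).2 hf
  exact (LieModule.mem_weightSpace (χ := χ) ⁅v, f⁆).1 (LieSubmodule.lie_mem _ hF) a

theorem derivation_sum_apply {ι R A M : Type*} [CommSemiring R] [CommSemiring A] [Algebra R A]
    [AddCommMonoid M] [Module A M] [Module R M] (s : Finset ι) (D : ι → Derivation R A M) (a : A) :
    (∑ i ∈ s, D i) a = ∑ i ∈ s, D i a :=
  (congrFun (map_sum Derivation.coeFnAddMonoidHom D s) a).trans (Finset.sum_apply _ _ _)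

theorem actDer_eq_sum {ι V : Type} [Fintype ι] [AddCommGroup V] [Module k V]
    [LieRingModule L V] (bV : Basis ι k V) (v : L) (f : MvPolynomial ι k) :
    actDer bV v f = ∑ j, pderiv j f * rep bV ⁅v, bV j⁆ := by
  classical
  have h : actDer bV v = ∑ j, rep bV ⁅v, bV j⁆ • (pderiv j : Derivation k _ _) := by
    refine MvPolynomial.derivation_ext fun i => ?_
    rw [derivation_sum_apply]
    simp [actDer, mkDerivation_X, pderiv_X, Pi.single_apply]
  simp [h, derivation_sum_apply, mul_comm]

/-- `rep` as a linear map. -/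
noncomputable def repLin {ι V : Type} [Fintype ι] [AddCommGroup V] [Module k V]
    (bV : Basis ι k V) : V →ₗ[k] MvPolynomial ι k where
  toFun := rep bV
  map_add' x y := by simp [rep, add_mul, Finset.sum_add_distrib]
  map_smul' c x := by simp [rep, Finset.smul_sum, MvPolynomial.smul_eq_C_mul, mul_assoc]

@[simp]
theorem repLin_apply {ι V : Type} [Fintype ι] [AddCommGroup V] [Module k V]
    (bV : Basis ι k V) (v : V) : repLin bV v = rep bV v := rfl

section Action

variable {ι V : Type} [Fintype ι] [AddCommGroup V] [Module k V]
  [LieRingModule L V] [LieModule k L V] (bV : Basis ι k V)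

theorem rep_basis (i : ι) : rep bV (bV i) = X i := by
  classical
  simp [rep, Finsupp.single_apply]

theorem actDer_rep (v : L) (w : V) : actDer bV v (rep bV w) = rep bV ⁅v, w⁆ := by
  have h : (actDer bV v).toLinearMap ∘ₗ repLin bV = repLin bV ∘ₗ LieModule.toEnd k L V v := by
    refine bV.ext fun i => ?_
    simp [rep_basis, actDer]
  exact LinearMap.congr_fun h w

theorem actDer_add (v w : L) (f : MvPolynomial ι k) :
    actDer bV (v + w) f = actDer bV v f + actDer bV w f := by
  simp only [actDer_eq_sum, add_lie, ← repLin_apply, map_add, mul_add, Finset.sum_add_distrib]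

theorem actDer_smul (c : k) (v : L) (f : MvPolynomial ι k) :
    actDer bV (c • v) f = c • actDer bV v f := by
  simp only [actDer_eq_sum, smul_lie, ← repLin_apply, map_smul, mul_smul_comm, Finset.smul_sum]

theorem actDer_lie (v w : L) : actDer bV ⁅v, w⁆ = ⁅actDer bV v, actDer bV w⁆ := by
  refine MvPolynomial.derivation_ext fun i => ?_
  rw [Derivation.commutator_apply, ← rep_basis bV i]
  rw [actDer_rep, actDer_rep, actDer_rep, actDer_rep, actDer_rep, lie_lie]
  exact map_sub (repLin bV) _ _

theorem totalDegree_actDer_le (v : L) (f : MvPolynomial ι k) :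
    (actDer bV v f).totalDegree ≤ f.totalDegree := by
  have hrep : ∀ w : V, (rep bV w).IsHomogeneous 1 := fun w =>
    IsHomogeneous.sum _ _ _ fun i _ => by simpa using (isHomogeneous_C ι _).mul (isHomogeneous_X k i)
  have hcomp : ∀ n, (actDer bV v (homogeneousComponent n f)).IsHomogeneous n := by
    intro n
    rw [actDer_eq_sum]
    refine IsHomogeneous.sum _ _ _ fun j _ => ?_
    rcases n with _ | n
    · simp [homogeneousComponent_zero, isHomogeneous_zero]
    · exact (homogeneousComponent_isHomogeneous (n + 1) f).pderiv.mul (hrep _)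
  conv_lhs => rw [← sum_homogeneousComponent f, map_sum]
  refine totalDegree_finsetSum_le fun n hn => ?_
  exact (hcomp n).totalDegree_le.trans (Nat.lt_succ_iff.mp (Finset.mem_range.mp hn))

/-- The `𝔤`-module structure on polynomials of bounded degree. -/
@[reducible]
noncomputable def degLieRingModule (N : ℕ) : LieRingModule L (restrictTotalDegree ι k N) where
  bracket v f := ⟨actDer bV v f, (mem_restrictTotalDegree _ _ _).2
    ((totalDegree_actDer_le bV v f).trans ((mem_restrictTotalDegree _ _ _).1 f.2))⟩
  add_lie v w f := Subtype.ext (actDer_add bV v w f)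
  lie_add v f g := Subtype.ext (map_add (actDer bV v) (f : MvPolynomial ι k) g)
  leibniz_lie v w f := Subtype.ext <| by
    change actDer bV v (actDer bV w f) =
      actDer bV ⁅v, w⁆ f + actDer bV w (actDer bV v (f : MvPolynomial ι k))
    rw [actDer_lie, Derivation.commutator_apply]
    abel

theorem degLieModule (N : ℕ) :
    letI := degLieRingModule (L := L) bV N
    LieModule k L (restrictTotalDegree ι k N) :=
  letI := degLieRingModule (L := L) bV N
  { smul_lie := fun c v f => Subtype.ext (actDer_smul bV c v f)
    lie_smul := fun c v f => Subtype.ext ((actDer bV v).map_smul c (f : MvPolynomial ι k)) }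

/-- The polynomials of bounded degree on which the ideal `I` acts with weight `χ`
form a `𝔤`-stable subspace. -/
theorem actDer_mem_weight [CharZero k] (I : LieIdeal k L) (χ : I → k) (f : MvPolynomial ι k)
    (hf : ∀ a : I, actDer bV (a : L) f = χ a • f) (v : L) (a : I) :
    actDer bV (a : L) (actDer bV v f) = χ a • actDer bV v f := by
  let _ := degLieRingModule (L := L) bV f.totalDegree
  have := degLieModule (L := L) bV f.totalDegree
  exact congrArg Subtype.val (lie_lie_eq_smul_of_weight I χ
    (⟨f, (mem_restrictTotalDegree _ _ _).2 le_rfl⟩ : restrictTotalDegree ι k f.totalDegree)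
    (fun a => Subtype.ext (hf a)) v a)

/-- If an endomorphism of a finite-dimensional space of polynomials acts as multiplication by an
element of the fraction field, then it is a scalar. -/
theorem exists_scalar_of_mul [IsAlgClosed k] (W : Submodule k (MvPolynomial ι k))
    [Module.Finite k W] (D : Module.End k W) (c : FractionRing (MvPolynomial ι k))
    (hD : ∀ g : W, algebraMap _ (FractionRing (MvPolynomial ι k)) (D g : MvPolynomial ι k) =
      c * algebraMap _ _ (g : MvPolynomial ι k)) :
    ∃ μ : k, ∀ g : W, D g = μ • g := by
  rcases subsingleton_or_nontrivial W with hW | hW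
  · exact ⟨0, fun g => Subsingleton.elim _ _⟩
  obtain ⟨μ, hμ⟩ := Module.End.exists_eigenvalue D
  obtain ⟨g, hg⟩ := hμ.exists_hasEigenvector
  have hinj := IsFractionRing.injective (MvPolynomial ι k) (FractionRing (MvPolynomial ι k))
  have hc : c = algebraMap _ _ (C μ : MvPolynomial ι k) := by
    have h := hD g
    rw [hg.apply_eq_smul, Submodule.coe_smul, MvPolynomial.smul_eq_C_mul, map_mul] at h
    refine (mul_right_cancel₀ ?_ h).symm
    rw [Ne, map_eq_zero_iff _ hinj]
    simpa using hg.2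
  refine ⟨μ, fun g => Subtype.ext (hinj ?_)⟩
  rw [hD g, hc, ← map_mul, Submodule.coe_smul, MvPolynomial.smul_eq_C_mul]

/-- If two families, the first contained in the span of the second, have structure matrices of the
same rank, then over the fraction field the second acts through combinations of the first. -/
theorem exists_actDer_eq_sum [DecidableEq ι] {κ κ' : Type} [Fintype κ] [Fintype κ']
    (vs : κ → L) (b : Basis κ' k L) (hrk : rkFam bV vs = rkFam bV b) (v : L) :
    ∃ p : κ → FractionRing (MvPolynomial ι k), ∀ f : MvPolynomial ι k,
      algebraMap _ (FractionRing (MvPolynomial ι k)) (actDer bV v f) =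
        ∑ i, p i * algebraMap _ _ (actDer bV (vs i) f) := by
  let K := FractionRing (MvPolynomial ι k)
  let col : L →ₗ[k] (ι → K) :=
    { toFun := fun v j => algebraMap _ K (rep bV ⁅v, bV j⁆)
      map_add' := fun v w => by
        ext j; simp only [add_lie, ← repLin_apply, map_add, Pi.add_apply]
      map_smul' := fun c v => by
        ext j
        simp only [smul_lie, ← repLin_apply, map_smul, Pi.smul_apply, RingHom.id_apply,
          MvPolynomial.smul_eq_C_mul, map_mul]
        rw [Algebra.smul_def, IsScalarTower.algebraMap_apply k (MvPolynomial ι k) K]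
        rfl }
  have hmem : ∀ w, col w ∈ Submodule.span K (Set.range fun i => col (b i)) := by
    intro w
    rw [← b.sum_repr w, map_sum]
    refine Submodule.sum_mem _ fun i _ => ?_
    rw [map_smul, ← algebraMap_smul K]
    exact Submodule.smul_mem _ _ (Submodule.subset_span ⟨i, rfl⟩)
  have hle : Submodule.span K (Set.range fun i => col (vs i)) ≤
      Submodule.span K (Set.range fun i => col (b i)) :=
    Submodule.span_le.2 (Set.range_subset_iff.2 fun i => hmem _)
  have heq := Submodule.eq_of_le_of_finrank_eq hle (by
    rw [rkFam, rkFam, Matrix.rank_eq_finrank_span_cols, Matrix.rank_eq_finrank_span_cols] at hrk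
    exact hrk)
  have hv := hmem v
  rw [← heq, Submodule.mem_span_range_iff_exists_fun] at hv
  obtain ⟨p, hp⟩ := hv
  refine ⟨p, fun f => ?_⟩
  have hpj : ∀ j, algebraMap _ (FractionRing (MvPolynomial ι k)) (rep bV ⁅v, bV j⁆) =
      ∑ i, p i * algebraMap _ _ (rep bV ⁅vs i, bV j⁆) := by
    intro j
    simpa [col] using (congrFun hp j).symm
  simp only [actDer_eq_sum, map_sum, map_mul]
  simp only [hpj, Finset.mul_sum]
  rw [Finset.sum_comm]
  exact Finset.sum_congr rfl fun i _ => Finset.sum_congr rfl fun j _ => mul_left_comm _ _ _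

/-- The polynomials of degree at most `N` on which the ideal `I` acts with weight `χ`. -/
noncomputable def weightPolys (I : LieIdeal k L) (χ : I → k) (N : ℕ) :
    Submodule k (MvPolynomial ι k) where
  carrier := {f | f.totalDegree ≤ N ∧ ∀ a : I, actDer bV (a : L) f = χ a • f}
  add_mem' := fun {f g} hf hg =>
    ⟨(totalDegree_add f g).trans (max_le hf.1 hg.1), fun a => by simp [hf.2 a, hg.2 a]⟩
  zero_mem' := by simp
  smul_mem' := fun c f hf =>
    ⟨(totalDegree_smul_le c f).trans hf.1, fun a => by
      rw [Derivation.map_smul, hf.2 a, smul_comm]⟩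

instance (I : LieIdeal k L) (χ : I → k) (N : ℕ) : Module.Finite k (weightPolys bV I χ N) :=
  Submodule.finiteDimensional_of_le (S₂ := restrictTotalDegree ι k N)
    fun _ hf => (mem_restrictTotalDegree _ _ _).2 hf.1

theorem exists_actDer_eq_smul [IsAlgClosed k] [CharZero k] [DecidableEq ι] {κ κ' : Type}
    [Fintype κ] [Fintype κ'] (I : LieIdeal k L) (vs : κ → I) (b : Basis κ' k L)
    (hrk : rkFam bV (fun i => (vs i : L)) = rkFam bV b) (χ : I → k) (f : MvPolynomial ι k)
    (hf : ∀ a : I, actDer bV (a : L) f = χ a • f) (v : L) :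
    ∃ μ : k, actDer bV v f = μ • f := by
  obtain ⟨p, hp⟩ := exists_actDer_eq_sum bV _ b hrk v
  have hstab : ∀ g ∈ weightPolys bV I χ f.totalDegree,
      actDer bV v g ∈ weightPolys bV I χ f.totalDegree := fun g hg =>
    ⟨(totalDegree_actDer_le bV v g).trans hg.1, actDer_mem_weight bV I χ g hg.2 v⟩
  obtain ⟨μ, hμ⟩ := exists_scalar_of_mul (weightPolys bV I χ f.totalDegree)
    ((actDer bV v).toLinearMap.restrict hstab)
    (∑ i, p i * algebraMap _ _ (C (χ (vs i)) : MvPolynomial ι k)) fun g => by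
      change algebraMap _ _ (actDer bV v g) = _
      rw [hp, Finset.sum_mul]
      refine Finset.sum_congr rfl fun i _ => ?_
      rw [g.2.2 (vs i), MvPolynomial.smul_eq_C_mul, map_mul, mul_assoc]
  exact ⟨μ, congrArg Subtype.val (hμ ⟨f, le_rfl, hf⟩)⟩

/-- An element that is a common eigenvector of `𝔤` is a semi-invariant: its weight is linear. -/
theorem exists_weight (f : MvPolynomial ι k) (h0 : f ≠ 0)
    (h : ∀ v : L, ∃ μ : k, actDer bV v f = μ • f) :
    ∃ χ : Module.Dual k L, ∀ v : L, actDer bV v f = χ v • f := by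
  choose χ hχ using h
  refine ⟨{ toFun := χ, map_add' := fun v w => ?_, map_smul' := fun c v => ?_ }, hχ⟩
  · exact smul_left_injective k h0 (by simp only [← hχ, actDer_add, add_smul])
  · exact smul_left_injective k h0 (by
      simp only [← hχ, actDer_smul, smul_eq_mul, mul_smul, RingHom.id_apply])

end Action

/-- If `𝔥` is an ideal of `𝔤` with `r_𝔥(V) = r_𝔤(V)` for a
finite-dimensional representation `V`, then `(SV)^𝔥_si = (SV)^𝔤_si`. -/
theorem statement11 {k : Type} [Field k] [IsAlgClosed k] [CharZero k]
    {L : Type} [LieRing L] [LieAlgebra k L]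
    {V : Type} [AddCommGroup V] [Module k V] [LieRingModule L V] [LieModule k L V]
    {ιV : Type} [Fintype ιV] [DecidableEq ιV] (bV : Basis ιV k V)
    {ι : Type} [Fintype ι] (b : Basis ι k L)
    (H : LieSubalgebra k L)
    (hId : ∀ (y x : L), x ∈ H → ⁅y, x⁆ ∈ H)
    {κ : Type} [Fintype κ] (bH : Basis κ k H)
    (hrk : rkFam bV (fun i => (bH i : L)) = rkFam bV b) :
    semiCenter bV ((↑) : H → L) = semiCenter bV (id : L → L) := by
  let I : LieIdeal k L := { H.toSubmodule with lie_mem := fun {y x} hx => hId y x hx }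
  refine congrArg (Algebra.adjoin k) (Set.Subset.antisymm ?_ ?_)
  · rintro f ⟨h0, χ, hχ⟩
    exact ⟨h0, exists_weight bV f h0 (exists_actDer_eq_smul bV I bH b hrk χ f hχ)⟩
  · rintro f ⟨h0, χ, hχ⟩
    exact ⟨h0, χ ∘ₗ H.toSubmodule.subtype, fun a => hχ a⟩

end Paper
end

section
/- Let 𝔤 be a finite-dimensional Lie algebra over k, let f ∈ S𝔤 be a semi-invariant with weight χ ∈ 𝔤*, and let 𝔥 = ker χ (an ideal of 𝔤, since χ vanishes on [𝔤,𝔤]). Then c(𝔤) = c(𝔥), i.e., (dim 𝔤 + i(𝔤))/2 = (dim 𝔥 + i(𝔥))/2. -/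
open Module MvPolynomial

namespace Paper

variable (k : Type) [Field k]

variable {k}
variable {L : Type} [LieRing L] [LieAlgebra k L]

/-- Along a line in a space of linear maps, the dimension of the kernel exceeds its value at a given
point at only finitely many other points. -/
theorem finite_setOf_finrank_ker_lt {K V W : Type*} [Field K] [AddCommGroup V] [Module K V]
    [FiniteDimensional K V] [AddCommGroup W] [Module K W] (A D : V →ₗ[K] W) :
    {t : K | finrank K (LinearMap.ker A) < finrank K (LinearMap.ker (A + t • D))}.Finite := by
  obtain ⟨C, hC⟩ := (LinearMap.ker A).exists_isCompl
  have hinj : LinearMap.ker (A ∘ₗ C.subtype) = ⊥ := by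
    rw [LinearMap.ker_eq_bot']
    intro c hc
    exact Subtype.ext (Submodule.disjoint_def.1 hC.disjoint c hc c.2)
  obtain ⟨G, hG⟩ := (A ∘ₗ C.subtype).exists_leftInverse_of_injective hinj
  let T : End K C := G ∘ₗ D ∘ₗ C.subtype
  have hfin : {μ : K | T.HasEigenvalue μ}.Finite := Module.End.finite_hasEigenvalue T
  refine (hfin.preimage (f := fun t : K => -t⁻¹)
    (neg_injective.comp inv_injective).injOn).subset ?_
  intro t ht
  by_contra hne
  refine absurd (Set.mem_ofPred_eq ▸ ht) (not_lt.2 ?_)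
  have hdisj : Disjoint (LinearMap.ker (A + t • D)) C := by
    rw [Submodule.disjoint_def]
    intro c hc hcC
    by_contra hc0
    apply hne
    have hsum : (⟨c, hcC⟩ : C) + t • T ⟨c, hcC⟩ = 0 := by
      have hGA : G (A c) = ⟨c, hcC⟩ := LinearMap.congr_fun hG ⟨c, hcC⟩
      have h := congrArg G (LinearMap.mem_ker.1 hc)
      simpa [T, hGA] using h
    have ht0 : t ≠ 0 := by
      rintro rfl
      simp at hsum
      exact hc0 hsum
    refine Module.End.hasEigenvalue_of_hasEigenvector (x := ⟨c, hcC⟩)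
      (Module.End.hasEigenvector_iff.2 ⟨Module.End.mem_eigenspace_iff.2 ?_, ?_⟩)
    · have h := congrArg (t⁻¹ • ·) hsum
      simp only [smul_add, smul_zero, inv_smul_smul₀ ht0] at h
      rw [neg_smul]
      exact eq_neg_of_add_eq_zero_right h
    · simpa [Subtype.ext_iff] using hc0
  have h₁ := Submodule.finrank_add_finrank_le_of_disjoint hdisj
  have h₂ := Submodule.finrank_add_eq_of_isCompl hC
  omega

/-- The alternating form `(v, w) ↦ x ⁅v, w⁆`, as a map `𝔤 → 𝔤*`. -/
noncomputable def bracketForm (x : Module.Dual k L) : L →ₗ[k] Module.Dual k L :=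
  (LieModule.toEnd k L L : L →ₗ[k] End k L).compr₂ x

@[simp] theorem bracketForm_apply (x : Module.Dual k L) (v w : L) :
    bracketForm x v w = x ⁅v, w⁆ := rfl

theorem ker_bracketForm (x : Module.Dual k L) : LinearMap.ker (bracketForm x) = stab k L x := by
  ext v
  simp [LinearMap.ext_iff, stab]

theorem finite_setOf_finrank_stab_lt [FiniteDimensional k L] (x y : Module.Dual k L) :
    {t : k | finrank k (stab k L x) < finrank k (stab k L (x + t • y))}.Finite := by
  have h := finite_setOf_finrank_ker_lt (bracketForm x) (bracketForm y)
  have hadd (t : k) : bracketForm x + t • bracketForm y = bracketForm (x + t • y) := by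
    ext v w
    simp
  refine h.subset fun t ht => ?_
  rw [Set.mem_ofPred_eq] at ht ⊢
  rwa [hadd, ker_bracketForm, ker_bracketForm]

theorem lieIndex_le (x : Module.Dual k L) : lieIndex k L ≤ finrank k (stab k L x) :=
  ciInf_le (OrderBot.bddBelow _) x

theorem exists_finrank_stab_eq_lieIndex (k L : Type) [Field k] [LieRing L] [LieAlgebra k L] :
    ∃ x : Module.Dual k L, finrank k (stab k L x) = lieIndex k L :=
  ciInf_mem _

theorem lieIndex_congr {L' : Type} [LieRing L'] [LieAlgebra k L'] (e : L ≃ₗ⁅k⁆ L') :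
    lieIndex k L = lieIndex k L' := by
  refine (e.toLinearEquiv.dualMap.toEquiv.iInf_congr fun x => ?_).symm
  have h : stab k L' x =
      (stab k L (e.toLinearEquiv.dualMap x)).map (e.toLinearEquiv : L →ₗ[k] L') := by
    ext v
    rw [Submodule.mem_map_equiv]
    constructor
    · intro hv w
      change x (e ⁅e.symm v, w⁆) = 0
      rw [LieEquiv.map_lie, LieEquiv.apply_symm_apply]
      exact hv (e w)
    · intro hv w
      have h : x (e ⁅e.symm v, e.symm w⁆) = 0 := hv (e.symm w)
      rwa [LieEquiv.map_lie, LieEquiv.apply_symm_apply, LieEquiv.apply_symm_apply] at h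
  exact (h ▸ LinearEquiv.finrank_map_eq e.toLinearEquiv _).symm

section Polynomial

variable {ι : Type} [Fintype ι] (b : Basis ι k L)

theorem evalAt_rep (x : Module.Dual k L) (v : L) : evalAt b x (rep b v) = x v := by
  conv_rhs => rw [← b.sum_repr v, map_sum]
  simp only [evalAt, rep, map_sum, map_mul, map_smul, aeval_X, smul_eq_mul, algHom_C,
    Algebra.algebraMap_self, RingHom.id_apply]

theorem evalAt_actDer_eq_zero {x : Module.Dual k L} {v : L} (hv : v ∈ stab k L x)
    (f : MvPolynomial ι k) : evalAt b x (actDer b v f) = 0 := by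
  have hv' : ∀ w, x ⁅v, w⁆ = 0 := hv
  induction f using MvPolynomial.induction_on with
  | C a => rw [← algebraMap_eq, Derivation.map_algebraMap, map_zero]
  | add p q hp hq => rw [map_add, map_add, hp, hq, add_zero]
  | mul_X p i hp =>
    have hX : evalAt b x (actDer b v (X i)) = 0 := by
      rw [actDer, mkDerivation_X, evalAt_rep, hv']
    simp only [Derivation.leibniz, map_add, smul_eq_mul, map_mul, hp, hX, mul_zero, add_zero]

theorem exists_evalAt_ne_zero [Infinite k] {f : MvPolynomial ι k} (hf : f ≠ 0) :
    ∃ x : Module.Dual k L, evalAt b x f ≠ 0 := by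
  by_contra! h
  refine hf (MvPolynomial.funext fun p => ?_)
  have h' := h (b.constr k p)
  simp only [evalAt, Basis.constr_basis, aeval_eq_eval] at h'
  simpa using h'

theorem finite_setOf_evalAt_eq_zero (f : MvPolynomial ι k) {x y : Module.Dual k L}
    (h : evalAt b y f ≠ 0) : {t : k | evalAt b (x + t • (y - x)) f = 0}.Finite := by
  let p : Polynomial k :=
    aeval (fun i => Polynomial.C (x (b i)) + Polynomial.X * Polynomial.C ((y - x) (b i))) f
  have hp (t : k) : p.eval t = evalAt b (x + t • (y - x)) f := by
    rw [← Polynomial.coe_aeval_eq_eval, ← AlgHom.comp_apply]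
    congr 1
    ext i
    simp [evalAt]
  have hp0 : p ≠ 0 := by
    rintro h0
    apply h
    have h1 := hp 1
    rw [h0] at h1
    simpa using h1.symm
  have h := Polynomial.finite_setOfPred_isRoot hp0
  simpa only [Polynomial.IsRoot, hp] using h

end Polynomial

/-- If the stabilizer of `x` is contained in the hyperplane `𝔥 = ker χ`, then restricting `x` to `𝔥`
increases the dimension of the stabilizer by one. -/
theorem finrank_stab_restrict [FiniteDimensional k L] {χ : Module.Dual k L} (hχ : χ ≠ 0)
    {H : LieSubalgebra k L} (hH : ∀ v, v ∈ H ↔ χ v = 0) {x : Module.Dual k L}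
    (hx : ∀ v ∈ stab k L x, χ v = 0) :
    finrank k (stab k H (x ∘ₗ H.toSubmodule.subtype)) = finrank k (stab k L x) + 1 := by
  obtain ⟨u, hu⟩ : ∃ u, χ u = 1 := LinearMap.surjective hχ 1
  obtain ⟨y, hy⟩ : ∃ y, ∀ w, x ⁅w, y⁆ = χ w := by
    have hmem : χ ∈ LinearMap.range (bracketForm x).dualMap := by
      rw [LinearMap.range_dualMap_eq_dualAnnihilator_ker, ker_bracketForm,
        Submodule.mem_dualAnnihilator]
      exact hx
    obtain ⟨ψ, hψ⟩ := hmem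
    obtain ⟨y, rfl⟩ := (Module.evalEquiv k L).surjective ψ
    exact ⟨y, fun w => LinearMap.congr_fun hψ w⟩
  have hyH : y ∈ H := (hH y).2 (by rw [← hy y]; simp)
  let R := stab k H (x ∘ₗ H.toSubmodule.subtype)
  have hyR : (⟨y, hyH⟩ : H) ∈ R := by
    intro w
    change x ⁅y, (w : L)⁆ = 0
    rw [← lie_skew, map_neg, hy, (hH w).1 w.2, neg_zero]
  let ι : R →ₗ[k] L := H.toSubmodule.subtype ∘ₗ R.subtype
  have hι : Function.Injective ι := Subtype.val_injective.comp Subtype.val_injective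
  let φ : R →ₗ[k] k := (bracketForm x).flip u ∘ₗ ι
  have hφ : φ ≠ 0 := by
    intro h
    have h1 : x ⁅y, u⁆ = 0 := LinearMap.congr_fun h ⟨⟨y, hyH⟩, hyR⟩
    rw [← lie_skew, map_neg, hy, hu] at h1
    simp at h1
  have hker : (LinearMap.ker φ).map ι = stab k L x := by
    ext v
    constructor
    · rintro ⟨r, hr, rfl⟩ w
      have h1 : x ⁅ι r, u⁆ = 0 := hr
      have hw : w - χ w • u ∈ H := (hH _).2 (by simp [hu])
      have h2 : x ⁅ι r, w - χ w • u⁆ = 0 := r.2 ⟨_, hw⟩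
      simpa [h1] using h2
    · intro hv
      exact ⟨⟨⟨v, (hH v).2 (hx v hv)⟩, fun w => hv w⟩, hv u, rfl⟩
  have h1 := φ.finrank_range_add_finrank_ker
  rw [LinearMap.range_eq_top.2 (LinearMap.surjective hφ), finrank_top, finrank_self] at h1
  have h2 : finrank k ((LinearMap.ker φ).map ι) = finrank k (LinearMap.ker φ) :=
    (Submodule.equivMapOfInjective ι hι _).finrank_eq.symm
  change finrank k R = _
  rw [← hker]
  omega

/-- If `f ∈ S𝔤` is a semi-invariant with weight `χ` and `𝔥 = ker χ`
(a Lie subalgebra, indeed an ideal, of `𝔤`), then `c(𝔤) = c(𝔥)`, i.e.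
`dim 𝔤 + i(𝔤) = dim 𝔥 + i(𝔥)`. -/
theorem statement13 {k : Type} [Field k] [IsAlgClosed k] [CharZero k]
    {L : Type} [LieRing L] [LieAlgebra k L]
    {ι : Type} [Fintype ι] [DecidableEq ι] (b : Basis ι k L)
    (f : MvPolynomial ι k) (χ : Module.Dual k L)
    (hf : f ≠ 0) (hsemi : ∀ v : L, actDer b v f = χ v • f)
    (H : LieSubalgebra k L) (hH : (H : Set L) = {v | χ v = 0}) :
    finrank k L + lieIndex k L = finrank k H + lieIndex k H := by
  have : FiniteDimensional k L := b.finiteDimensional_of_finite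
  have hH' : ∀ v, v ∈ H ↔ χ v = 0 := fun v => Set.ext_iff.1 hH v
  rcases eq_or_ne χ 0 with rfl | hχ
  · obtain rfl : H = ⊤ := by
      ext v
      simp [hH']
    rw [lieIndex_congr (LieSubalgebra.topEquiv (R := k) (L := L)),
      (LieSubalgebra.topEquiv (R := k) (L := L)).toLinearEquiv.finrank_eq]
  let j : H →ₗ[k] L := H.toSubmodule.subtype
  have hrestrict {x : Module.Dual k L} (hx : evalAt b x f ≠ 0) :
      finrank k (stab k H (x ∘ₗ j)) = finrank k (stab k L x) + 1 := by
    refine finrank_stab_restrict hχ hH' fun v hv => ?_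
    have h := evalAt_actDer_eq_zero b hv f
    rw [hsemi, map_smul, smul_eq_mul] at h
    exact (mul_eq_zero.1 h).resolve_right hx
  obtain ⟨z, hz⟩ := exists_evalAt_ne_zero b hf
  have hle : lieIndex k H ≤ lieIndex k L + 1 := by
    obtain ⟨x, hx⟩ := exists_finrank_stab_eq_lieIndex k L
    obtain ⟨t, ht⟩ := ((finite_setOf_evalAt_eq_zero b f (x := x) hz).union
      (finite_setOf_finrank_stab_lt x (z - x))).exists_notMem
    simp only [Set.mem_union, Set.mem_ofPred_eq, not_or, not_lt] at ht
    have h := lieIndex_le ((x + t • (z - x)) ∘ₗ j)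
    rw [hrestrict ht.1] at h
    omega
  have hge : lieIndex k L + 1 ≤ lieIndex k H := by
    obtain ⟨x', hx'⟩ := exists_finrank_stab_eq_lieIndex k H
    obtain ⟨x, rfl⟩ : ∃ x : Module.Dual k L, x ∘ₗ j = x' :=
      LinearMap.exists_extend (p := H.toSubmodule) x'
    obtain ⟨t, ht⟩ := ((finite_setOf_evalAt_eq_zero b f (x := x) hz).union
      (finite_setOf_finrank_stab_lt (x ∘ₗ j) ((z - x) ∘ₗ j))).exists_notMem
    simp only [Set.mem_union, Set.mem_ofPred_eq, not_or, not_lt] at ht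
    have h := lieIndex_le (x + t • (z - x))
    have h' := hrestrict ht.1
    rw [LinearMap.add_comp, LinearMap.smul_comp] at h'
    omega
  have hdim : finrank k H + 1 = finrank k L := by
    have hHker : H.toSubmodule = LinearMap.ker χ := Submodule.ext hH'
    have h := Module.Dual.finrank_ker_add_one_of_ne_zero hχ
    rwa [← hHker] at h
  omega

end Paper
end

section
/- Let L/k be a finitely generated field extension on which the finite-dimensional Lie algebra 𝔤 acts by k-derivations, and let K = L^𝔤. If trdeg_K L = dim 𝔤 − dim_L ker(ρ), where ρ : L ⊗_k 𝔤 → Der_k(L) is the L-linear map induced by the action, then the action is geometric, i.e., the induced map L ⊗_K 𝔤 → Der_K(L) is surjective. -/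
open Module MvPolynomial

namespace Paper

variable (k : Type) [Field k]

variable {k}
variable {L : Type} [LieRing L] [LieAlgebra k L]

/-- A `k`-derivation vanishing on an intermediate field `K` is a `K`-derivation. -/
def derivationOver {k F : Type} [Field k] [Field F] [Algebra k F] (K : IntermediateField k F)
    (E : Derivation k F F) (hE : ∀ x ∈ K, E x = 0) : Derivation K F F where
  toFun := E
  map_add' := E.map_add
  map_smul' c x := by
    simp [IntermediateField.smul_def, hE c c.2]
  map_one_eq_zero' := E.map_one_eq_zero
  leibniz' := E.leibniz

theorem derivation_eq_zero_of_isTranscendenceBasis {k F ι : Type} [Field k] [CharZero k] [Field F]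
    [Algebra k F] {x : ι → F} (hx : IsTranscendenceBasis k x) (E : Derivation k F F)
    (hE : ∀ i, E (x i) = 0) : E = 0 := by
  have halg := hx.isAlgebraic_field
  have hle : IntermediateField.adjoin k (Set.range x) ≤ invField fun _ : Unit => E := by
    rw [IntermediateField.adjoin_le_iff]
    rintro _ ⟨i, rfl⟩ _
    exact hE i
  have hzero : ∀ y ∈ IntermediateField.adjoin k (Set.range x), E y = 0 :=
    fun y hy => hle hy ()
  have hunr : Algebra.FormallyUnramified (IntermediateField.adjoin k (Set.range x)) F :=
    Algebra.FormallyUnramified.of_isSeparable _ F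
  have hsub : Subsingleton
      (Derivation (IntermediateField.adjoin k (Set.range x)) F F) :=
    (KaehlerDifferential.linearMapEquivDerivation _ F).symm.toEquiv.subsingleton
  ext y
  exact DFunLike.congr_fun
    (Subsingleton.elim (derivationOver (IntermediateField.adjoin k (Set.range x)) E hzero) 0) y

/-- The `F`-space of linear maps underlying the `k`-derivations of `F` vanishing on `K`. -/
def derivationsOver {k F : Type} [Field k] [Field F] [Algebra k F] (K : IntermediateField k F) :
    Submodule F (F →ₗ[k] F) where
  carrier := {f | ∃ E : Derivation k F F, (∀ x ∈ K, E x = 0) ∧ E.toLinearMap = f}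
  add_mem' := by
    rintro _ _ ⟨E, hE, rfl⟩ ⟨E', hE', rfl⟩
    exact ⟨E + E', fun x hx => by simp [hE x hx, hE' x hx], rfl⟩
  zero_mem' := ⟨0, by simp, rfl⟩
  smul_mem' := by
    rintro c _ ⟨E, hE, rfl⟩
    exact ⟨c • E, fun x hx => by simp [hE x hx], rfl⟩

/-- Evaluation of the derivations vanishing on `K` at a family of elements. -/
def evalDerivations {k F ι : Type} [Field k] [Field F] [Algebra k F] (K : IntermediateField k F)
    (x : ι → F) : derivationsOver K →ₗ[F] (ι → F) where
  toFun f i := f.1 (x i)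
  map_add' _ _ := rfl
  map_smul' _ _ := rfl

theorem evalDerivations_injective {k F ι : Type} [Field k] [CharZero k] [Field F] [Algebra k F]
    (K : IntermediateField k F) {x : ι → F} (hx : IsTranscendenceBasis K x) :
    Function.Injective (evalDerivations K x) := by
  rw [injective_iff_map_eq_zero]
  rintro ⟨_, E, hE, rfl⟩ h
  have hzero := derivation_eq_zero_of_isTranscendenceBasis hx (derivationOver K E hE)
    fun i => congr_fun h i
  ext y
  exact DFunLike.congr_fun hzero y

theorem range_rhoMap {k G κ F : Type} [Field k] [AddCommGroup G] [Module k G]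
    (bG : Basis κ k G) [Field F] [Algebra k F] (D : G → Derivation k F F) :
    LinearMap.range (rhoMap bG D) =
      Submodule.span F (Set.range fun i => (D (bG i)).toLinearMap) := by
  rw [rhoMap, Basis.constr_range]

/-- If `L/k` is a finitely generated field extension with `𝔤` acting by
`k`-derivations and `K = L^𝔤`, and `trdeg_K L = dim 𝔤 − dim_L ker ρ` for
`ρ : L ⊗_k 𝔤 → Der_k(L)`, then the action is geometric. -/
theorem statement15 {k : Type} [Field k] [IsAlgClosed k] [CharZero k]
    {G : Type} [LieRing G] [LieAlgebra k G] [FiniteDimensional k G]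
    {κ : Type} [Fintype κ] (bG : Basis κ k G)
    {F : Type} [Field F] [Algebra k F]
    (hfg : ∃ s : Finset F, IntermediateField.adjoin k (s : Set F) = ⊤)
    (D : G → Derivation k F F)
    (hadd : ∀ u v : G, D (u + v) = D u + D v)
    (hsmul : ∀ (c : k) (v : G), D (c • v) = c • D v)
    (hlie : ∀ (u v : G) (x : F), D ⁅u, v⁆ x = D u (D v x) - D v (D u x))
    (htr : ∃ t : Finset F,
      IsTranscendenceBasis (invField D) (fun i : t => (i : F)) ∧
      t.card = finrank k G - finrank F (LinearMap.ker (rhoMap bG D))) :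
    IsGeometric D := by
  obtain ⟨t, ht, hcard⟩ := htr
  have hinj := evalDerivations_injective (invField D) ht
  have hfin : FiniteDimensional F (derivationsOver (invField D)) :=
    FiniteDimensional.of_injective _ hinj
  have hdim : finrank F (derivationsOver (invField D)) ≤ t.card := by
    simpa using LinearMap.finrank_le_finrank_of_injective hinj
  have hle : LinearMap.range (rhoMap bG D) ≤ derivationsOver (invField D) := by
    rw [range_rhoMap, Submodule.span_le]
    rintro _ ⟨i, rfl⟩
    exact ⟨D (bG i), fun x hx => hx _, rfl⟩
  have hrank : finrank F (LinearMap.range (rhoMap bG D)) = t.card := by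
    have hnull := LinearMap.finrank_range_add_finrank_ker (rhoMap bG D)
    rw [Module.finrank_baseChange] at hnull
    omega
  have heq : LinearMap.range (rhoMap bG D) = derivationsOver (invField D) :=
    Submodule.eq_of_le_of_finrank_le hle (hdim.trans hrank.ge)
  intro E hE
  have hmem : E.toLinearMap ∈ LinearMap.range (rhoMap bG D) := heq ▸ ⟨E, hE, rfl⟩
  rw [range_rhoMap] at hmem
  refine Submodule.span_mono ?_ hmem
  rintro _ ⟨i, rfl⟩
  exact ⟨bG i, rfl⟩

end Paper
end

section
/- Let S be a finitely generated integral domain over k on which the finite-dimensional Lie algebra 𝔤 acts by k-derivations, and let L be the fraction field of S. Then the induced action of 𝔤 on L is geometric if and only if trdeg_{L^𝔤} L = dim 𝔤 − min_m dim 𝔤_m, where the minimum is over all maximal ideals m of S and 𝔤_m = {v ∈ 𝔤 : v(f) ∈ m for all f ∈ S}. -/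
open Module MvPolynomial

namespace Paper

variable (k : Type) [Field k]

variable {k}
variable {L : Type} [LieRing L] [LieAlgebra k L]

theorem exists_det_ne_zero_of_linearIndependent {K X : Type*} [Field K] {n : ℕ}
    {g : Fin n → X → K} (h : LinearIndependent K g) :
    ∃ x : Fin n → X, (Matrix.of fun i j => g i (x j)).det ≠ 0 := by
  have hspan : Submodule.span K (Set.range fun (x : X) (i : Fin n) => g i x) = ⊤ := by
    by_contra hne
    obtain ⟨f, hf0, hf⟩ := Submodule.exists_le_ker_of_lt_top _ (lt_top_iff_ne_top.2 hne)
    apply hf0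
    have hsum : ∑ i, f (Pi.single i 1) • g i = 0 := by
      funext x
      have hx : f (fun i => g i x) = 0 := hf (Submodule.subset_span ⟨x, rfl⟩)
      rw [LinearMap.pi_apply_eq_sum_univ] at hx
      simp only [Finset.sum_apply, Pi.smul_apply, Pi.zero_apply, smul_eq_mul]
      rw [← hx]
      refine Finset.sum_congr rfl fun i _ => ?_
      rw [smul_eq_mul, mul_comm]
      congr 2
      funext j
      simp [Pi.single_apply, eq_comm]
    have hz := Fintype.linearIndependent_iff.1 h _ hsum
    ext i
    simpa using hz i
  obtain ⟨b, hbs, hbspan, hbi⟩ :=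
    exists_linearIndependent K (Set.range fun (x : X) (i : Fin n) => g i x)
  rw [hspan] at hbspan
  let B : Basis b K (Fin n → K) := Basis.mk hbi (by simp [hbspan])
  have e : b ≃ Fin n := B.indexEquiv (Pi.basisFun K (Fin n))
  choose y hy using fun c : b => hbs c.2
  refine ⟨fun j => y (e.symm j), fun hdet => ?_⟩
  have hcols : (fun (j : Fin n) (i : Fin n) => g i (y (e.symm j))) = Subtype.val ∘ e.symm :=
    funext fun j => hy _
  have hunit : IsUnit (Matrix.of fun i j => g i (y (e.symm j))).transpose := by
    refine Matrix.linearIndependent_rows_iff_isUnit.1 ?_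
    change LinearIndependent K (fun (j : Fin n) (i : Fin n) => g i (y (e.symm j)))
    rw [hcols]
    exact hbi.comp e.symm e.symm.injective
  rw [Matrix.isUnit_transpose, Matrix.isUnit_iff_isUnit_det, hdet] at hunit
  exact not_isUnit_zero hunit

theorem linearIndependent_of_det_ne_zero {K X : Type*} [Field K] {n : ℕ}
    {g : Fin n → X → K} (x : Fin n → X) (h : (Matrix.of fun i j => g i (x j)).det ≠ 0) :
    LinearIndependent K g :=
  LinearIndependent.of_comp (LinearMap.funLeft K K x)
    (Matrix.linearIndependent_rows_of_det_ne_zero h)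

open scoped IntermediateField.algebraAdjoinAdjoin in
theorem finrank_derivation_of_isTranscendenceBasis {K L ι : Type} [Field K] [CharZero K] [Field L]
    [Algebra K L] [Fintype ι] {v : ι → L} (hv : IsTranscendenceBasis K v) :
    Module.Finite L (Derivation K L L) ∧ finrank L (Derivation K L L) = Fintype.card ι := by
  let P := MvPolynomial ι K
  let A := Algebra.adjoin K (Set.range v)
  let E := IntermediateField.adjoin K (Set.range v)
  let : Algebra P L := (aeval v : P →ₐ[K] L).toRingHom.toAlgebra
  let : Algebra P A := hv.1.aevalEquiv.toRingHom.toAlgebra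
  have : IsScalarTower K P L :=
    IsScalarTower.of_algebraMap_eq' (aeval v : P →ₐ[K] L).comp_algebraMap.symm
  have : IsScalarTower P A L := IsScalarTower.of_algebraMap_eq fun p => by
    exact (hv.1.algebraMap_aevalEquiv p).symm
  have hPA : Algebra.FormallyEtale P A :=
    .of_equiv (AlgEquiv.ofBijective (Algebra.ofId P A) hv.1.aevalEquiv.bijective)
  have hAE : Algebra.FormallyEtale A E := .of_isLocalization (nonZeroDivisors _)
  have : Algebra.IsAlgebraic E L := hv.isAlgebraic_field
  have hEL : Algebra.FormallyEtale E L := .of_isSeparable _ _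
  have hAL : Algebra.FormallyEtale A L := .comp A E L
  have hPL : Algebra.FormallyEtale P L := .comp P A L
  let B : Basis ι L (Ω[L⁄K]) := ((KaehlerDifferential.mvPolynomialBasis K ι).baseChange L).map
    (KaehlerDifferential.tensorKaehlerEquivOfFormallyEtale K P L)
  have : Module.Finite L (Ω[L⁄K]) := .of_basis B
  let e := KaehlerDifferential.linearMapEquivDerivation K L (M := L)
  exact ⟨Module.Finite.equiv e, by
    rw [← e.finrank_eq, finrank_linearMap_self, finrank_eq_card_basis B]⟩

theorem exists_algHom_ker_eq {k S : Type*} [Field k] [IsAlgClosed k] [CommRing S] [Algebra k S]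
    [Algebra.FiniteType k S] (m : Ideal S) [m.IsMaximal] :
    ∃ π : S →ₐ[k] k, ∀ s, π s = 0 ↔ s ∈ m := by
  let : Field (S ⧸ m) := Ideal.Quotient.field m
  have : Module.Finite k (S ⧸ m) := finite_of_finite_type_of_isJacobsonRing k (S ⧸ m)
  let e : k ≃ₐ[k] S ⧸ m := AlgEquiv.ofBijective (Algebra.ofId k (S ⧸ m))
    (IsAlgClosed.algebraMap_bijective_of_isIntegral (k := k))
  refine ⟨(e.symm : (S ⧸ m) →ₐ[k] k).comp (Ideal.Quotient.mkₐ k m), fun s => ?_⟩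
  simp [Ideal.Quotient.eq_zero_iff_mem]

theorem exists_isMaximal_notMem {k S : Type*} [Field k] [CommRing S] [IsDomain S] [Algebra k S]
    [Algebra.FiniteType k S] {s : S} (hs : s ≠ 0) : ∃ m : Ideal S, m.IsMaximal ∧ s ∉ m := by
  have : IsJacobsonRing S := isJacobsonRing_of_finiteType (A := k)
  have hbot : (⊥ : Ideal S).jacobson = ⊥ :=
    IsJacobsonRing.out' _ (Ideal.isPrime_bot (α := S)).isRadical
  by_contra! h
  apply hs
  rw [← Ideal.mem_bot, ← hbot, Ideal.jacobson, Ideal.mem_sInf]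
  exact fun {m} hm => h m hm.2

/-- The linear map sending `v` to the tangent vector `s ↦ π (D v s)` at the point `π`. -/
def tangentMap {k G S : Type*} [Field k] [AddCommGroup G] [Module k G] [CommRing S] [Algebra k S]
    (D : G →ₗ[k] Derivation k S S) (π : S →ₐ[k] k) : G →ₗ[k] (S → k) where
  toFun v s := π (D v s)
  map_add' u v := by ext; simp
  map_smul' c v := by ext; simp

theorem finrank_range_tangentMap_le {k G S F : Type*} [Field k] [AddCommGroup G] [Module k G]
    [FiniteDimensional k G] [CommRing S] [Algebra k S] [Field F] [Algebra S F] [FaithfulSMul S F]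
    [Algebra k F] (D : G →ₗ[k] Derivation k S S) (DF : G → Derivation k F F)
    (hcompat : ∀ v a, DF v (algebraMap S F a) = algebraMap S F (D v a))
    [FiniteDimensional F (Submodule.span F (Set.range fun v => (DF v).toLinearMap))]
    (π : S →ₐ[k] k) :
    finrank k (LinearMap.range (tangentMap D π)) ≤
      finrank F (Submodule.span F (Set.range fun v => (DF v).toLinearMap)) := by
  let b := finBasis k (LinearMap.range (tangentMap D π))
  choose v hv using fun i => LinearMap.mem_range.1 (b i).2
  have hind : LinearIndependent k fun i => tangentMap D π (v i) := by
    simp_rw [hv]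
    exact b.linearIndependent.map' (LinearMap.range (tangentMap D π)).subtype
      (Submodule.ker_subtype _)
  obtain ⟨x, hx⟩ := exists_det_ne_zero_of_linearIndependent hind
  let M := Matrix.of fun i j => D (v i) (x j)
  have hM : M.det ≠ 0 := by
    intro h0
    apply hx
    change (π.toRingHom.mapMatrix M).det = 0
    rw [← RingHom.map_det, h0, map_zero]
  have hMF : (Matrix.of fun i j => DF (v i) (algebraMap S F (x j))).det ≠ 0 := by
    simp_rw [hcompat]
    have := (algebraMap S F).map_det M
    intro h0
    apply hM
    apply FaithfulSMul.algebraMap_injective S F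
    rw [this, map_zero]
    exact h0
  have hli : LinearIndependent F fun i => (DF (v i)).toLinearMap :=
    LinearIndependent.of_comp (LinearMap.ltoFun k F F F)
      (linearIndependent_of_det_ne_zero (g := fun i => ⇑(DF (v i))) _ hMF)
  calc _ = finrank F (Submodule.span F (Set.range fun i => (DF (v i)).toLinearMap)) := by
        rw [finrank_span_eq_card hli, Fintype.card_fin]
    _ ≤ _ := Submodule.finrank_mono (Submodule.span_mono (by rintro _ ⟨i, rfl⟩; exact ⟨v i, rfl⟩))

theorem eq_zero_of_forall_algebraMap {k S F : Type*} [Field k] [CommRing S] [IsDomain S]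
    [Field F] [Algebra S F] [IsFractionRing S F] [Algebra k F] (E : Derivation k F F)
    (h : ∀ s, E (algebraMap S F s) = 0) : E = 0 := by
  ext x
  obtain ⟨a, b, -, rfl⟩ := IsFractionRing.div_surjective (A := S) x
  simp [Derivation.leibniz_div, h]

theorem exists_isMaximal_finrank_le {k G S F : Type*} [Field k] [AddCommGroup G] [Module k G]
    [FiniteDimensional k G] [CommRing S] [IsDomain S] [Algebra k S] [Algebra.FiniteType k S]
    [Field F] [Algebra S F] [IsFractionRing S F]
    [Algebra k F] (D : G →ₗ[k] Derivation k S S) (DF : G → Derivation k F F)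
    (hcompat : ∀ v a, DF v (algebraMap S F a) = algebraMap S F (D v a))
    [FiniteDimensional F (Submodule.span F (Set.range fun v => (DF v).toLinearMap))] :
    ∃ m : Ideal S, m.IsMaximal ∧ ∀ π : S →ₐ[k] k, (∀ s, π s = 0 ↔ s ∈ m) →
      finrank F (Submodule.span F (Set.range fun v => (DF v).toLinearMap)) ≤
        finrank k (LinearMap.range (tangentMap D π)) := by
  obtain ⟨f, hf, -, hli⟩ := Submodule.exists_fun_fin_finrank_span_eq F
    (Set.range fun v => (DF v).toLinearMap)
  choose v hv using hf
  have hind : LinearIndependent F fun i (s : S) => DF (v i) (algebraMap S F s) := by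
    rw [Fintype.linearIndependent_iff] at hli ⊢
    intro a ha
    apply hli
    have h0 : ∑ i, a i • DF (v i) = 0 := by
      refine eq_zero_of_forall_algebraMap (S := S) _ fun s => ?_
      change Derivation.coeFnAddMonoidHom _ _ = _
      rw [map_sum]
      simpa using congrFun ha s
    ext x
    have := DFunLike.congr_fun h0 x
    change Derivation.coeFnAddMonoidHom _ x = _ at this
    rw [map_sum] at this
    simpa [← hv] using this
  obtain ⟨x, hx⟩ := exists_det_ne_zero_of_linearIndependent hind
  let M := Matrix.of fun i j => D (v i) (x j)
  have hM : M.det ≠ 0 := by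
    intro h0
    apply hx
    have := (algebraMap S F).map_det M
    rw [h0, map_zero] at this
    simp_rw [hcompat]
    exact this.symm
  obtain ⟨m, hm, hMm⟩ := exists_isMaximal_notMem (k := k) hM
  refine ⟨m, hm, fun π hπ => ?_⟩
  have hdet : (Matrix.of fun i j => π (D (v i) (x j))).det ≠ 0 := by
    intro h0
    apply hMm
    rw [← hπ]
    exact (π.toRingHom.map_det M).trans h0
  have hli' : LinearIndependent k fun i => tangentMap D π (v i) :=
    linearIndependent_of_det_ne_zero x hdet
  have hli'' : LinearIndependent k fun i => (tangentMap D π).rangeRestrict (v i) :=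
    LinearIndependent.of_comp (Submodule.subtype _) hli'
  simpa using hli''.fintype_card_le_finrank

theorem finrank_sub_sInf_finrank_stabilizer {k G S F : Type*} [Field k] [IsAlgClosed k]
    [AddCommGroup G] [Module k G]
    [FiniteDimensional k G] [CommRing S] [IsDomain S] [Algebra k S] [Algebra.FiniteType k S]
    [Field F] [Algebra S F] [IsFractionRing S F]
    [Algebra k F] (D : G →ₗ[k] Derivation k S S) (DF : G → Derivation k F F)
    (hcompat : ∀ v a, DF v (algebraMap S F a) = algebraMap S F (D v a))
    [FiniteDimensional F (Submodule.span F (Set.range fun v => (DF v).toLinearMap))] :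
    finrank k G - sInf {n | ∃ m : Ideal S, m.IsMaximal ∧
        n = finrank k (Submodule.span k {v : G | ∀ f : S, D v f ∈ m})} =
      finrank F (Submodule.span F (Set.range fun v => (DF v).toLinearMap)) := by
  have : FaithfulSMul S F := (faithfulSMul_iff_algebraMap_injective S F).2
    (IsFractionRing.injective S F)
  have hker (m : Ideal S) (π : S →ₐ[k] k) (hπ : ∀ s, π s = 0 ↔ s ∈ m) :
      finrank k (LinearMap.range (tangentMap D π)) +
        finrank k (Submodule.span k {v : G | ∀ f : S, D v f ∈ m}) = finrank k G := by
    have hset : {v : G | ∀ f : S, D v f ∈ m} = LinearMap.ker (tangentMap D π) := by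
      ext v
      simp [funext_iff, tangentMap, hπ]
    rw [hset, Submodule.span_eq]
    exact LinearMap.finrank_range_add_finrank_ker _
  obtain ⟨m, hm, hle⟩ := exists_isMaximal_finrank_le D DF hcompat
  obtain ⟨π, hπ⟩ := exists_algHom_ker_eq (k := k) m
  have h₁ := hle π hπ
  have h₂ := hker m π hπ
  set A := {n | ∃ m : Ideal S, m.IsMaximal ∧
        n = finrank k (Submodule.span k {v : G | ∀ f : S, D v f ∈ m})}
  have hmA : finrank k (Submodule.span k {v : G | ∀ f : S, D v f ∈ m}) ∈ A := ⟨m, hm, rfl⟩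
  have h₃ := Nat.sInf_le hmA
  obtain ⟨m', hm', hA⟩ := Nat.sInf_mem ⟨_, hmA⟩
  obtain ⟨π', hπ'⟩ := exists_algHom_ker_eq (k := k) m'
  have h₄ := hker m' π' hπ'
  have h₅ := finrank_range_tangentMap_le D DF hcompat π'
  omega

/-- Forgetting from `K`-derivations to `k`-linear maps. -/
def restrictScalarsToLinearMap (k K F : Type*) [Field k] [Field K] [Field F] [Algebra k F]
    [Algebra K F] [Algebra k K] [IsScalarTower k K F] : Derivation K F F →ₗ[F] (F →ₗ[k] F) where
  toFun E := E.toLinearMap.restrictScalars k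
  map_add' _ _ := rfl
  map_smul' _ _ := rfl

theorem restrictScalarsToLinearMap_injective (k K F : Type*) [Field k] [Field K] [Field F]
    [Algebra k F] [Algebra K F] [Algebra k K] [IsScalarTower k K F] :
    Function.Injective (restrictScalarsToLinearMap k K F) :=
  fun _ _ h => Derivation.ext fun x => LinearMap.congr_fun h x

theorem exists_derivation_invField {k F G : Type} [Field k] [Field F] [Algebra k F]
    (D : G → Derivation k F F) (E : Derivation k F F)
    (hE : ∀ x : F, (∀ v : G, D v x = 0) → E x = 0) :
    E.toLinearMap ∈ LinearMap.range (restrictScalarsToLinearMap k (invField D) F) := by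
  refine ⟨Derivation.mk' { toFun := E, map_add' := map_add E, map_smul' := fun c x => ?_ }
    E.leibniz, rfl⟩
  have hc : E (c : F) = 0 := hE c c.2
  simp [Algebra.smul_def, E.leibniz, hc]

theorem span_derivations_le {k F G : Type} [Field k] [Field F] [Algebra k F]
    (D : G → Derivation k F F) :
    Submodule.span F (Set.range fun v => (D v).toLinearMap) ≤
      LinearMap.range (restrictScalarsToLinearMap k (invField D) F) := by
  rw [Submodule.span_le]
  rintro _ ⟨v, rfl⟩
  exact exists_derivation_invField D (D v) fun x hx => hx v

theorem isGeometric_iff_range_le {k F G : Type} [Field k] [Field F] [Algebra k F]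
    (D : G → Derivation k F F) :
    IsGeometric D ↔ LinearMap.range (restrictScalarsToLinearMap k (invField D) F) ≤
      Submodule.span F (Set.range fun v => (D v).toLinearMap) := by
  constructor
  · rintro h _ ⟨E, rfl⟩
    exact h (E.restrictScalars k) fun x hx => E.map_algebraMap (⟨x, hx⟩ : invField D)
  · intro h E hE
    exact h (exists_derivation_invField D E hE)

theorem isGeometric_iff_card_eq {k F G : Type} [Field k] [CharZero k] [Field F] [Algebra k F]
    (D : G → Derivation k F F) {t : Finset F}
    (ht : IsTranscendenceBasis (invField D) (fun i : t => (i : F))) :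
    FiniteDimensional F (Submodule.span F (Set.range fun v => (D v).toLinearMap)) ∧
    (IsGeometric D ↔
      t.card = finrank F (Submodule.span F (Set.range fun v => (D v).toLinearMap))) := by
  have : CharZero (invField D) := charZero_of_injective_algebraMap (algebraMap k _).injective
  obtain ⟨hfin, hcard⟩ := finrank_derivation_of_isTranscendenceBasis ht
  have hrange : finrank F (LinearMap.range (restrictScalarsToLinearMap k (invField D) F)) =
      t.card := by
    rw [LinearMap.finrank_range_of_inj (restrictScalarsToLinearMap_injective _ _ _), hcard,
      Fintype.card_coe]
  have hle := span_derivations_le D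
  refine ⟨Submodule.finiteDimensional_of_le hle, ?_⟩
  rw [isGeometric_iff_range_le, ← hrange]
  exact ⟨fun h => by rw [le_antisymm h hle],
    fun h => (Submodule.eq_of_le_of_finrank_eq hle h.symm).ge⟩

theorem exists_finset_isTranscendenceBasis_of_isFractionRing {k S F : Type} [Field k]
    [CommRing S] [IsDomain S] [Algebra k S] [Algebra.FiniteType k S] [Field F] [Algebra S F]
    [IsFractionRing S F] [Algebra k F] [IsScalarTower k S F] (K : IntermediateField k F) :
    ∃ t : Finset F, IsTranscendenceBasis K ((↑) : t → F) := by
  have : Algebra.EssFiniteType S F := .of_isLocalization F (nonZeroDivisors S)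
  have : Algebra.EssFiniteType k F := .comp k S F
  have : Algebra.EssFiniteType K F := .of_comp k K F
  exact exists_finset_isTranscendenceBasis K F

/-- For a finitely generated domain `S` over `k` with a `𝔤`-action by
derivations and fraction field `L`, the induced action on `L` is geometric iff
`trdeg_{L^𝔤} L = dim 𝔤 − min_m dim 𝔤_m`, the minimum being over maximal ideals `m ⊆ S`,
with `𝔤_m = {v : ∀ f, v(f) ∈ m}`. -/
theorem statement16 {k : Type} [Field k] [IsAlgClosed k] [CharZero k]
    {G : Type} [LieRing G] [LieAlgebra k G] [FiniteDimensional k G]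
    {S : Type} [CommRing S] [IsDomain S] [Algebra k S]
    (hfgS : Algebra.FiniteType k S)
    (D : G → Derivation k S S)
    (hadd : ∀ u v : G, D (u + v) = D u + D v)
    (hsmul : ∀ (c : k) (v : G), D (c • v) = c • D v)
    (hlie : ∀ (u v : G) (x : S), D ⁅u, v⁆ x = D u (D v x) - D v (D u x))
    -- `F` is the fraction field of `S`
    {F : Type} [Field F] [Algebra S F] [IsFractionRing S F]
    [Algebra k F] [IsScalarTower k S F]
    -- `DF` is the (unique) extension of the action to `F` by derivations
    (DF : G → Derivation k F F)
    (hcompat : ∀ (v : G) (a : S), DF v (algebraMap S F a) = algebraMap S F (D v a)) :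
    IsGeometric DF ↔
      ∃ t : Finset F,
        IsTranscendenceBasis (invField DF) (fun i : t => (i : F)) ∧
        t.card = finrank k G -
          sInf {n | ∃ m : Ideal S, m.IsMaximal ∧
            n = finrank k (Submodule.span k {v : G | ∀ f : S, D v f ∈ m})} := by
  let DL : G →ₗ[k] Derivation k S S :=
    { toFun := D, map_add' := hadd, map_smul' := hsmul }
  obtain ⟨t, ht⟩ := exists_finset_isTranscendenceBasis_of_isFractionRing (S := S) (invField DF)
  obtain ⟨hfin, hgeom⟩ := isGeometric_iff_card_eq DF ht
  have hrank : finrank k G - sInf {n | ∃ m : Ideal S, m.IsMaximal ∧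
        n = finrank k (Submodule.span k {v : G | ∀ f : S, D v f ∈ m})} =
      finrank F (Submodule.span F (Set.range fun v => (DF v).toLinearMap)) :=
    finrank_sub_sInf_finrank_stabilizer DL DF hcompat
  rw [hrank]
  exact ⟨fun h => ⟨t, ht, hgeom.1 h⟩,
    fun ⟨_, hu, hcard⟩ => (isGeometric_iff_card_eq DF hu).2.2 hcard⟩

end Paper
end

section
/- Let S = k ⊕ S_1 ⊕ S_2 ⊕ ⋯ be a connected graded factorial domain (each S_n finite-dimensional over k, S not necessarily finitely generated) and let the finite-dimensional Lie algebra 𝔤 act on S by degree-preserving derivations, such that S contains no proper semi-invariants. Then S^𝔤 is factorial, and Q(S)^𝔤 = Q(S^𝔤) inside Q(S). -/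
open Module MvPolynomial

namespace Paper

variable (k : Type) [Field k]

variable {k}
variable {L : Type} [LieRing L] [LieAlgebra k L]

section GradedDegree

variable {R A : Type*} [CommRing R] [CommRing A] [Algebra R A]
  (𝒜 : ℕ → Submodule R A) [GradedAlgebra 𝒜]

theorem exists_top_component {x : A} (hx : x ≠ 0) :
    ∃ n, (DirectSum.decompose 𝒜 x n : A) ≠ 0 ∧
      ∀ m, n < m → (DirectSum.decompose 𝒜 x m : A) = 0 := by
  classical
  have hne : (DirectSum.decompose 𝒜 x).support.Nonempty := by
    rw [Finset.nonempty_iff_ne_empty, Ne, DFinsupp.support_eq_empty]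
    exact fun h => hx ((DirectSum.decompose 𝒜).injective
      (h.trans (DirectSum.decompose_zero 𝒜).symm))
  refine ⟨(DirectSum.decompose 𝒜 x).support.max' hne, ?_, fun m hm => ?_⟩
  · exact fun h => DFinsupp.mem_support_iff.1 (Finset.max'_mem _ hne) (Subtype.ext h)
  · by_contra h
    have hmem : m ∈ (DirectSum.decompose 𝒜 x).support :=
      DFinsupp.mem_support_iff.2 fun h0 => h (by rw [h0]; rfl)
    exact absurd (Finset.le_max' _ m hmem) (not_le.2 hm)

/-- A multiplier that does not raise the degree of a nonzero element of a graded domain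
lies in degree zero. -/
theorem mem_zero_of_mul_of_component_eq_zero [IsDomain A] {a f g : A} (hf : f ≠ 0)
    (hg : ∀ n, (DirectSum.decompose 𝒜 f n : A) = 0 → (DirectSum.decompose 𝒜 g n : A) = 0)
    (h : g = a * f) : a ∈ 𝒜 0 := by
  classical
  rcases eq_or_ne a 0 with rfl | ha
  · exact zero_mem _
  obtain ⟨s, hs, hs'⟩ := exists_top_component 𝒜 ha
  obtain ⟨t, ht, ht'⟩ := exists_top_component 𝒜 hf
  have htop : (DirectSum.decompose 𝒜 g (s + t) : A)
      = DirectSum.decompose 𝒜 a s * DirectSum.decompose 𝒜 f t := by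
    rw [h, DirectSum.decompose_mul, DirectSum.coe_mul_apply_eq_sum_antidiagonal]
    refine Finset.sum_eq_single (s, t) (fun ij hij hne => ?_) fun hn => ?_
    · have hsum := Finset.HasAntidiagonal.mem_antidiagonal.1 hij
      rcases lt_trichotomy ij.1 s with hlt | heq | hgt
      · rw [ht' ij.2 (by omega), mul_zero]
      · exact absurd (Prod.ext heq (by simp only; omega)) hne
      · rw [hs' ij.1 hgt, zero_mul]
    · exact (hn (Finset.HasAntidiagonal.mem_antidiagonal.2 rfl)).elim
  have hs0 : s = 0 := by
    by_contra hs0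
    exact mul_ne_zero hs ht (htop ▸ hg _ (ht' _ (by omega)))
  subst hs0
  rw [← DirectSum.sum_support_decompose 𝒜 a]
  refine sum_mem fun i hi => ?_
  rcases Nat.eq_zero_or_pos i with rfl | hi0
  · exact SetLike.coe_mem _
  · rw [hs' i hi0]
    exact zero_mem _

theorem decompose_map_of_preserves (d : A →ₗ[R] A) (hd : ∀ n, ∀ x ∈ 𝒜 n, d x ∈ 𝒜 n)
    (x : A) (n : ℕ) :
    (DirectSum.decompose 𝒜 (d x) n : A) = d (DirectSum.decompose 𝒜 x n) := by
  induction x using DirectSum.Decomposition.inductionOn 𝒜 with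
  | zero => simp
  | @homogeneous i m =>
    rcases eq_or_ne i n with rfl | hne
    · rw [DirectSum.decompose_of_mem_same 𝒜 (hd _ _ m.2), DirectSum.decompose_of_mem_same 𝒜 m.2]
    · rw [DirectSum.decompose_of_mem_ne 𝒜 (hd _ _ m.2) hne,
        DirectSum.decompose_of_mem_ne 𝒜 m.2 hne, map_zero]
  | add x y hx hy => simp [hx, hy]

end GradedDegree

/-- A derivation of a factorial domain of characteristic zero preserves the ideal generated by
each prime factor of each of its constants. -/
theorem prime_dvd_derivation_of_dvd_constant {R A : Type*} [Field R] [CharZero R] [CommRing A]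
    [IsDomain A] [Algebra R A] [UniqueFactorizationMonoid A] (d : Derivation R A A)
    {p f : A} (hp : Prime p) (hf : f ≠ 0) (hdf : d f = 0) (hpf : p ∣ f) : p ∣ d p := by
  obtain ⟨g, hfg, hpg⟩ := (FiniteMultiplicity.of_prime_left hp hf).exists_eq_pow_mul_and_not_dvd
  obtain ⟨m, hm⟩ : ∃ m, multiplicity p f = m + 1 := by
    refine Nat.exists_eq_succ_of_ne_zero fun h0 => hpg ?_
    rw [h0, pow_zero, one_mul] at hfg
    exact hfg ▸ hpf
  rw [hm] at hfg
  have key : p ^ m * (((m + 1 : ℕ) : A) * g * d p + p * d g) = 0 := by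
    rw [← hdf, hfg, Derivation.leibniz, Derivation.leibniz_pow]
    simp only [smul_eq_mul, nsmul_eq_mul, Nat.add_sub_cancel]
    ring
  have key' := (mul_eq_zero.1 key).resolve_left (pow_ne_zero _ hp.ne_zero)
  have hdvd : p ∣ ((m + 1 : ℕ) : A) * g * d p :=
    (dvd_add_left (dvd_mul_right p (d g))).1 (key' ▸ dvd_zero p)
  have hunit : IsUnit ((m + 1 : ℕ) : A) := by
    rw [← map_natCast (algebraMap R A)]
    exact (IsUnit.mk0 _ (Nat.cast_ne_zero.2 m.succ_ne_zero)).map _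
  rcases hp.dvd_or_dvd hdvd with h | h
  · rcases hp.dvd_or_dvd h with h | h
    · exact absurd (isUnit_of_dvd_unit h hunit) hp.not_isUnit
    · exact absurd h hpg
  · exact h

section Invariants

variable {K H A : Type} [Field K] [CommRing A] [IsDomain A] [Algebra K A]
  {D : H → Derivation K A A}

theorem mem_invariantsOf_of_mul_left {a b : A} (ha : a ∈ invariantsOf D) (ha0 : a ≠ 0)
    (hab : a * b ∈ invariantsOf D) : b ∈ invariantsOf D := by
  intro v
  have h := hab v
  rw [Derivation.leibniz, ha v, smul_zero, add_zero, smul_eq_mul] at h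
  exact (mul_eq_zero.1 h).resolve_left ha0

theorem prime_invariantsOf {p : A} (hp : Prime p) (hpD : p ∈ invariantsOf D) :
    Prime (⟨p, hpD⟩ : invariantsOf D) := by
  refine ⟨fun h => hp.ne_zero (congrArg Subtype.val h),
    fun h => hp.not_isUnit (h.map (invariantsOf D).subtype), fun a b hab => ?_⟩
  have lift : ∀ c : invariantsOf D, p ∣ (c : A) → (⟨p, hpD⟩ : invariantsOf D) ∣ c := by
    rintro ⟨c, hc⟩ ⟨e, rfl⟩
    exact ⟨⟨e, mem_invariantsOf_of_mul_left hpD hp.ne_zero hc⟩, rfl⟩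
  exact (hp.dvd_or_dvd (map_dvd (invariantsOf D).subtype hab)).imp (lift a) (lift b)

/-- If each prime factor of an invariant is invariant, then the invariants are factorial. -/
theorem uniqueFactorizationMonoid_invariantsOf [UniqueFactorizationMonoid A]
    (hprime : ∀ p f : A, Prime p → f ≠ 0 → f ∈ invariantsOf D → p ∣ f → p ∈ invariantsOf D) :
    UniqueFactorizationMonoid (invariantsOf D) := by
  apply UniqueFactorizationMonoid.of_exists_prime_factors
  suffices h : ∀ f : A, f ≠ 0 → ∀ hf : f ∈ invariantsOf D,
      ∃ s : Multiset (invariantsOf D), (∀ b ∈ s, Prime b) ∧ Associated s.prod ⟨f, hf⟩ from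
    fun a ha => h a (fun h0 => ha (Subtype.ext h0)) a.2
  intro f
  induction f using UniqueFactorizationMonoid.induction_on_prime with
  | h₁ => exact fun h => absurd rfl h
  | h₂ u hu =>
    intro hu0 huD
    obtain ⟨w, hw⟩ := hu.exists_right_inv
    have hwD : w ∈ invariantsOf D :=
      mem_invariantsOf_of_mul_left huD hu0 (hw ▸ one_mem _)
    refine ⟨0, by simp, ?_⟩
    rw [Multiset.prod_zero]
    exact (associated_one_iff_isUnit.2
      (IsUnit.of_mul_eq_one ⟨w, hwD⟩ (Subtype.ext hw))).symm
  | h₃ a p ha hp ih =>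
    intro hpa hpaD
    have hpD := hprime p _ hp hpa hpaD (dvd_mul_right p a)
    have haD := mem_invariantsOf_of_mul_left hpD hp.ne_zero hpaD
    obtain ⟨s, hs, hsa⟩ := ih ha haD
    refine ⟨⟨p, hpD⟩ ::ₘ s, ?_, ?_⟩
    · intro b hb
      rcases Multiset.mem_cons.1 hb with rfl | hb
      · exact prime_invariantsOf hp hpD
      · exact hs b hb
    · rw [Multiset.prod_cons]
      exact hsa.mul_left ⟨p, hpD⟩

/-- If each `f` dividing all of its derivatives is invariant, then every invariant fraction is a
quotient of invariants. -/
theorem invField_eq_adjoin_invariantsOf [UniqueFactorizationMonoid A]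
    (hdvd : ∀ f : A, (∀ v, f ∣ D v f) → f ∈ invariantsOf D)
    {F : Type} [Field F] [Algebra A F] [IsFractionRing A F] [Algebra K F]
    (DF : H → Derivation K F F)
    (hcompat : ∀ v a, DF v (algebraMap A F a) = algebraMap A F (D v a)) :
    invField DF = IntermediateField.adjoin K (algebraMap A F '' (invariantsOf D : Set A)) := by
  apply le_antisymm
  · intro x hx
    obtain ⟨a, ⟨b, hb⟩, hrel, hab⟩ := IsFractionRing.exists_reduced_fraction A x
    have hb0 : algebraMap A F b ≠ 0 := IsFractionRing.to_map_ne_zero_of_mem_nonZeroDivisors hb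
    have hxb : x * algebraMap A F b = algebraMap A F a :=
      (IsLocalization.eq_mk'_iff_mul_eq (y := ⟨b, hb⟩)).1 hab.symm
    have hcross : ∀ v, a * D v b = b * D v a := by
      intro v
      have h := congrArg (DF v) hxb
      rw [Derivation.leibniz, hx v, smul_zero, add_zero, hcompat, hcompat, smul_eq_mul] at h
      apply IsFractionRing.injective A F
      rw [map_mul, map_mul, ← h, ← hxb]
      ring
    have ha : a ∈ invariantsOf D := hdvd a fun v =>
      hrel.dvd_of_dvd_mul_left (hcross v ▸ dvd_mul_right a _)
    have hbD : b ∈ invariantsOf D := hdvd b fun v =>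
      hrel.symm.dvd_of_dvd_mul_left ((hcross v).symm ▸ dvd_mul_right b _)
    rw [eq_div_of_mul_eq hb0 hxb]
    exact div_mem (IntermediateField.subset_adjoin K _ ⟨a, ha, rfl⟩)
      (IntermediateField.subset_adjoin K _ ⟨b, hbD, rfl⟩)
  · rw [IntermediateField.adjoin_le_iff]
    rintro _ ⟨a, ha, rfl⟩ v
    rw [hcompat, ha v, map_zero]

/-- In a connected graded domain without proper semi-invariants, an element dividing all of its
derivatives is invariant. -/
theorem mem_invariantsOf_of_dvd [AddCommGroup H] [Module K H]
    (𝒜 : ℕ → Submodule K A) [GradedAlgebra 𝒜] (hconn : 𝒜 0 = Submodule.span K {1})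
    (hadd : ∀ u v, D (u + v) = D u + D v) (hsmul : ∀ (c : K) v, D (c • v) = c • D v)
    (hgr : ∀ v n, ∀ x ∈ 𝒜 n, D v x ∈ 𝒜 n)
    (hnoproper : ∀ (f : A) (χ : Module.Dual K H), f ≠ 0 → (∀ v, D v f = χ v • f) → χ = 0)
    {f : A} (hf : ∀ v, f ∣ D v f) : f ∈ invariantsOf D := by
  rcases eq_or_ne f 0 with rfl | hf0
  · exact zero_mem _
  have hscalar : ∀ v, ∃ c : K, D v f = c • f := by
    intro v
    obtain ⟨a, ha⟩ := hf v
    have ha0 : a ∈ 𝒜 0 := by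
      refine mem_zero_of_mul_of_component_eq_zero 𝒜 hf0 (fun n hn => ?_) (ha.trans (mul_comm f a))
      exact (decompose_map_of_preserves 𝒜 (D v).toLinearMap (hgr v) f n).trans
        (by rw [hn, map_zero])
    rw [hconn, Submodule.mem_span_singleton] at ha0
    obtain ⟨c, rfl⟩ := ha0
    exact ⟨c, by rw [ha, mul_smul_comm, mul_one]⟩
  choose χ hχ using hscalar
  have hinj : Function.Injective fun c : K => c • f := smul_left_injective K hf0
  let χ' : Module.Dual K H :=
    { toFun := χ
      map_add' := fun u v => hinj <| by
        simp only [add_smul, ← hχ, hadd, Derivation.add_apply]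
      map_smul' := fun c v => hinj <| by
        simp only [RingHom.id_apply, smul_assoc, ← hχ, hsmul, Derivation.smul_apply] }
  have h0 : χ' = 0 := hnoproper f χ' hf0 hχ
  intro v
  rw [hχ v, show χ v = 0 from LinearMap.congr_fun h0 v, zero_smul]

end Invariants

/-- Let `S` be a connected graded factorial domain with a
degree-preserving `𝔤`-action by derivations and no proper semi-invariants. Then `S^𝔤` is
factorial and `Q(S)^𝔤 = Q(S^𝔤)` inside `Q(S)`. -/
theorem statement17 {k : Type} [Field k] [IsAlgClosed k] [CharZero k]
    {G : Type} [LieRing G] [LieAlgebra k G] [FiniteDimensional k G]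
    {S : Type} [CommRing S] [IsDomain S] [Algebra k S] [UniqueFactorizationMonoid S]
    (𝒜 : ℕ → Submodule k S) [GradedAlgebra 𝒜]
    (hconn : 𝒜 0 = Submodule.span k {1})
    (hfd : ∀ n, FiniteDimensional k (𝒜 n))
    (D : G → Derivation k S S)
    (hadd : ∀ u v : G, D (u + v) = D u + D v)
    (hsmul : ∀ (c : k) (v : G), D (c • v) = c • D v)
    (hlie : ∀ (u v : G) (x : S), D ⁅u, v⁆ x = D u (D v x) - D v (D u x))
    (hgr : ∀ (v : G) (n : ℕ) (x : S), x ∈ 𝒜 n → D v x ∈ 𝒜 n)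
    (hnoproper : ∀ (f : S) (χ : Module.Dual k G), f ≠ 0 →
      (∀ v : G, D v f = χ v • f) → χ = 0)
    -- `F` is the fraction field of `S`
    {F : Type} [Field F] [Algebra S F] [IsFractionRing S F]
    [Algebra k F] [IsScalarTower k S F]
    -- `DF` is the (unique) extension of the action to `F` by derivations
    (DF : G → Derivation k F F)
    (hcompat : ∀ (v : G) (a : S), DF v (algebraMap S F a) = algebraMap S F (D v a)) :
    UniqueFactorizationMonoid (invariantsOf D) ∧
      invField DF
        = IntermediateField.adjoin k (algebraMap S F '' (invariantsOf D : Set S)) := by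
  have hdvd : ∀ f : S, (∀ v, f ∣ D v f) → f ∈ invariantsOf D := fun f hf =>
    mem_invariantsOf_of_dvd 𝒜 hconn hadd hsmul hgr hnoproper hf
  exact ⟨uniqueFactorizationMonoid_invariantsOf fun p f hp hf0 hf hpf =>
      hdvd p fun v => prime_dvd_derivation_of_dvd_constant (D v) hp hf0 (hf v) hpf,
    invField_eq_adjoin_invariantsOf hdvd DF hcompat⟩

end Paper
end
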